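/- (Achievability/equality at the uniform distribution for covariant memory cells.) Let G be a finite group, d ≥ 1, and let U : G → (d×d unitary matrices) satisfy: (i) multiplicativity as channels, i.e., for all g,h ∈ G and all d×d matrices X, U(g)U(h)·X·U(h)†U(g)† = U(gh)·X·U(gh)†; and (ii) the unitary one-design property, i.e., for all d×d matrices X, (1/|G|)·∑_{g∈G} U(g) X U(g)† = (Tr X / d)·I_d. Let N be a trace-preserving Kraus channel from ℂ^d to ℂ^{d'}, and let V : G → (d'×d' unitary matrices) satisfy N(U(g) X U(g)†) = V(g) N(X) V(g)† for all g ∈ G and all X. For g ∈ G define ω^g := (id_d ⊗ N)((I_d⊗U(g)) Φ_d (I_d⊗U(g))†). Then for the uniform distribution on G: H((1/|G|)·∑_{g∈G} ω^g) − (1/|G|)·∑_{g∈G} H(ω^g) = log₂ d + H(N(I_d/d)) − H((id_d⊗N)(Φ_d)). -/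

import Mathlib

open Matrix Kronecker BigOperators ComplexOrder

/-- von Neumann entropy (base 2) of a matrix, via its eigenvalues when Hermitian. -/
noncomputable def vnEntropy {n : Type*} [Fintype n] [DecidableEq n] (ρ : Matrix n n ℂ) : ℝ :=
  if h : ρ.IsHermitian then -∑ i, (h.eigenvalues i) * Real.logb 2 (h.eigenvalues i) else 0

/-- Application of a map given by a Kraus family. -/
noncomputable def krausApply {a b ι : Type*} [Fintype a] [Fintype b] [Fintype ι]
    (K : ι → Matrix b a ℂ) (X : Matrix a a ℂ) : Matrix b b ℂ :=
  ∑ j, K j * X * (K j)ᴴ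

/-- Application of `id ⊗ (Kraus channel)`, acting on the second tensor factor. -/
noncomputable def idTensorApply {r a b ι : Type*} [Fintype r] [DecidableEq r]
    [Fintype a] [Fintype b] [Fintype ι]
    (K : ι → Matrix b a ℂ) (X : Matrix (r × a) (r × a) ℂ) : Matrix (r × b) (r × b) ℂ :=
  ∑ j, ((1 : Matrix r r ℂ) ⊗ₖ K j) * X * ((1 : Matrix r r ℂ) ⊗ₖ K j)ᴴ

/-- The maximally entangled state `Φ_d` on `ℂ^d ⊗ ℂ^d`. -/
noncomputable def maxEnt (d : ℕ) : Matrix (Fin d × Fin d) (Fin d × Fin d) ℂ :=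
  Matrix.of (fun p q => if p.1 = p.2 ∧ q.1 = q.2 then (d : ℂ)⁻¹ else 0)

/-- The state `ω^g = (id ⊗ N)((1 ⊗ U(g)) Φ_d (1 ⊗ U(g))†)`. -/
noncomputable def omegaG {G : Type} {d d' kN : ℕ}
    (U : G → Matrix (Fin d) (Fin d) ℂ) (KN : Fin kN → Matrix (Fin d') (Fin d) ℂ)
    (g : G) : Matrix (Fin d × Fin d') (Fin d × Fin d') ℂ :=
  idTensorApply KN
    ((((1 : Matrix (Fin d) (Fin d) ℂ) ⊗ₖ U g)) * maxEnt d *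
      (((1 : Matrix (Fin d) (Fin d) ℂ) ⊗ₖ U g))ᴴ)

/-- The entropy of a Hermitian matrix whose characteristic polynomial has the roots `f i`. -/
theorem vnEntropy_eq_of_charpoly {n : Type*} [Fintype n] [DecidableEq n] {A : Matrix n n ℂ}
    (hA : A.IsHermitian) (f : n → ℝ)
    (hf : A.charpoly = ∏ i, (Polynomial.X - Polynomial.C (f i : ℂ))) :
    vnEntropy A = -∑ i, f i * Real.logb 2 (f i) := by
  have hroots : Multiset.map (fun i => (hA.eigenvalues i : ℂ)) Finset.univ.val =
      Multiset.map (fun i => (f i : ℂ)) Finset.univ.val := by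
    have h := hA.roots_charpoly_eq_eigenvalues
    rw [hf, Polynomial.roots_prod _ _
      (by simp [Finset.prod_ne_zero_iff, Polynomial.X_sub_C_ne_zero])] at h
    simpa [Function.comp_def] using h.symm
  have hsum := congrArg
    (fun s => (s.map fun z : ℂ => z.re * Real.logb 2 z.re).sum) hroots
  simp only [Multiset.map_map, Function.comp_def, Complex.ofReal_re] at hsum
  rw [vnEntropy, dif_pos hA]
  exact congrArg Neg.neg hsum

theorem charpoly_unitary_conj {n : Type*} [Fintype n] [DecidableEq n] {W : Matrix n n ℂ}
    (hW : Wᴴ * W = 1) (A : Matrix n n ℂ) : (W * A * Wᴴ).charpoly = A.charpoly := by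
  rw [Matrix.charpoly_mul_comm, ← Matrix.mul_assoc, hW, Matrix.one_mul]

theorem vnEntropy_unitary_conj {n : Type*} [Fintype n] [DecidableEq n] {W : Matrix n n ℂ}
    (hW : Wᴴ * W = 1) {A : Matrix n n ℂ} (hA : A.IsHermitian) :
    vnEntropy (W * A * Wᴴ) = vnEntropy A := by
  rw [vnEntropy_eq_of_charpoly (isHermitian_mul_mul_conjTranspose W hA) hA.eigenvalues
    ((charpoly_unitary_conj hW A).trans hA.charpoly_eq), vnEntropy, dif_pos hA]

/-- The entropy of the product of a maximally mixed state with a state of trace one. -/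
theorem vnEntropy_maximallyMixed_kronecker {n : Type*} [Fintype n] [DecidableEq n] {d : ℕ}
    (hd : d ≠ 0) {σ : Matrix n n ℂ} (hσ : σ.IsHermitian) (htr : σ.trace = 1) :
    vnEntropy (((d : ℂ)⁻¹ • (1 : Matrix (Fin d) (Fin d) ℂ)) ⊗ₖ σ) =
      Real.logb 2 d + vnEntropy σ := by
  have hsum : ∑ i, hσ.eigenvalues i = 1 := by
    have h := hσ.trace_eq_sum_eigenvalues
    rw [htr] at h
    apply Complex.ofReal_injective
    simpa using h.symm
  have hd' : (d : ℝ) ≠ 0 := Nat.cast_ne_zero.mpr hd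
  set W : Matrix n n ℂ := hσ.eigenvectorUnitary.val
  have hWW : Wᴴ * W = 1 := Unitary.coe_star_mul_self hσ.eigenvectorUnitary
  have hspec : σ = W * diagonal (fun i => (hσ.eigenvalues i : ℂ)) * Wᴴ := by
    have h := hσ.spectral_theorem
    rwa [Unitary.conjStarAlgAut_apply] at h
  have hW1 : ((1 : Matrix (Fin d) (Fin d) ℂ) ⊗ₖ W)ᴴ *
      ((1 : Matrix (Fin d) (Fin d) ℂ) ⊗ₖ W) = 1 := by
    rw [conjTranspose_kronecker, ← mul_kronecker_mul, hWW]
    simp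
  have hdiag : ((d : ℂ)⁻¹ • (1 : Matrix (Fin d) (Fin d) ℂ)) ⊗ₖ σ =
      ((1 : Matrix (Fin d) (Fin d) ℂ) ⊗ₖ W) *
        diagonal (fun p : Fin d × n => (((d : ℝ)⁻¹ * hσ.eigenvalues p.2 : ℝ) : ℂ)) *
        ((1 : Matrix (Fin d) (Fin d) ℂ) ⊗ₖ W)ᴴ := by
    have h : diagonal (fun p : Fin d × n => (((d : ℝ)⁻¹ * hσ.eigenvalues p.2 : ℝ) : ℂ)) =
        ((d : ℂ)⁻¹ • (1 : Matrix (Fin d) (Fin d) ℂ)) ⊗ₖ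
          diagonal (fun i => (hσ.eigenvalues i : ℂ)) := by
      rw [smul_one_eq_diagonal, diagonal_kronecker_diagonal]
      simp
    rw [h, conjTranspose_kronecker, ← mul_kronecker_mul, ← mul_kronecker_mul, ← hspec]
    simp
  have hherm : (diagonal
      (fun p : Fin d × n => (((d : ℝ)⁻¹ * hσ.eigenvalues p.2 : ℝ) : ℂ))).IsHermitian := by
    refine isHermitian_diagonal_of_self_adjoint _ ?_
    ext p
    simp
  rw [hdiag, vnEntropy_unitary_conj hW1 hherm,
    vnEntropy_eq_of_charpoly hherm _ (charpoly_diagonal _), vnEntropy, dif_pos hσ,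
    Fintype.sum_prod_type]
  have hterm : ∀ i, (d : ℝ)⁻¹ * hσ.eigenvalues i * Real.logb 2 ((d : ℝ)⁻¹ * hσ.eigenvalues i) =
      (d : ℝ)⁻¹ * (hσ.eigenvalues i * Real.logb 2 (hσ.eigenvalues i) -
        hσ.eigenvalues i * Real.logb 2 d) := by
    intro i
    by_cases h : hσ.eigenvalues i = 0
    · simp [h]
    · rw [Real.logb_mul (inv_ne_zero hd') h, Real.logb_inv]
      ring
  simp only [hterm]
  simp only [← Finset.mul_sum, Finset.sum_sub_distrib]
  rw [← Finset.sum_mul (f := hσ.eigenvalues), hsum]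
  simp only [Finset.sum_const, Finset.card_univ, Fintype.card_fin, nsmul_eq_mul]
  field_simp
  ring

theorem krausApply_isHermitian {a b ι : Type*} [Fintype a] [Fintype b] [Fintype ι]
    (K : ι → Matrix b a ℂ) {X : Matrix a a ℂ} (hX : X.IsHermitian) :
    (krausApply K X).IsHermitian := by
  simp [IsHermitian, krausApply, conjTranspose_sum, Matrix.mul_assoc, hX.eq]

theorem idTensorApply_isHermitian {r a b ι : Type*} [Fintype r] [DecidableEq r]
    [Fintype a] [Fintype b] [Fintype ι] (K : ι → Matrix b a ℂ)
    {X : Matrix (r × a) (r × a) ℂ} (hX : X.IsHermitian) : (idTensorApply K X).IsHermitian :=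
  krausApply_isHermitian (fun j => (1 : Matrix r r ℂ) ⊗ₖ K j) hX

theorem trace_krausApply {a b ι : Type*} [Fintype a] [DecidableEq a] [Fintype b] [Fintype ι]
    {K : ι → Matrix b a ℂ} (hK : ∑ j, (K j)ᴴ * K j = 1) (X : Matrix a a ℂ) :
    (krausApply K X).trace = X.trace := by
  simp_rw [krausApply, trace_sum, trace_mul_cycle (K _) X, ← trace_sum]
  rw [← Finset.sum_mul, hK, Matrix.one_mul]

theorem krausApply_smul {a b ι : Type*} [Fintype a] [Fintype b] [Fintype ι]
    (K : ι → Matrix b a ℂ) (c : ℂ) (X : Matrix a a ℂ) :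
    krausApply K (c • X) = c • krausApply K X := by
  simp [krausApply, Finset.smul_sum]

theorem krausApply_sum {a b ι κ : Type*} [Fintype a] [Fintype b] [Fintype ι] [Fintype κ]
    (K : ι → Matrix b a ℂ) (X : κ → Matrix a a ℂ) :
    krausApply K (∑ g, X g) = ∑ g, krausApply K (X g) := by
  simp only [krausApply, Matrix.mul_sum, Matrix.sum_mul]
  exact Finset.sum_comm

/-- The blocks of a matrix conjugated by `1 ⊗ M` are the conjugated blocks. -/
theorem submatrix_one_kronecker_conj {r a b : Type*} [Fintype r] [DecidableEq r] [Fintype a]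
    [Fintype b] (M : Matrix b a ℂ) (X : Matrix (r × a) (r × a) ℂ) (i j : r) :
    (((1 : Matrix r r ℂ) ⊗ₖ M) * X * ((1 : Matrix r r ℂ) ⊗ₖ M)ᴴ).submatrix
        (Prod.mk i) (Prod.mk j) =
      M * X.submatrix (Prod.mk i) (Prod.mk j) * Mᴴ := by
  ext p q
  simp [Matrix.mul_apply, Fintype.sum_prod_type, Matrix.one_apply, Finset.sum_mul, ite_mul,
    apply_ite]

theorem submatrix_idTensorApply {r a b ι : Type*} [Fintype r] [DecidableEq r]
    [Fintype a] [Fintype b] [Fintype ι] (K : ι → Matrix b a ℂ)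
    (X : Matrix (r × a) (r × a) ℂ) (i j : r) :
    (idTensorApply K X).submatrix (Prod.mk i) (Prod.mk j) =
      krausApply K (X.submatrix (Prod.mk i) (Prod.mk j)) := by
  simp_rw [krausApply, ← submatrix_one_kronecker_conj]
  ext p q
  simp [idTensorApply, Matrix.sum_apply]

theorem ext_submatrix_prodMk {r b : Type*} {X Y : Matrix (r × b) (r × b) ℂ}
    (h : ∀ i j, X.submatrix (Prod.mk i) (Prod.mk j) = Y.submatrix (Prod.mk i) (Prod.mk j)) :
    X = Y := by
  ext ⟨i, p⟩ ⟨j, q⟩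
  exact congrFun (congrFun (h i j) p) q

theorem maxEnt_isHermitian (d : ℕ) : (maxEnt d).IsHermitian := by
  ext p q
  simp only [maxEnt, conjTranspose_apply, of_apply, and_comm]
  split_ifs <;> simp

theorem trace_submatrix_maxEnt {d : ℕ} (i j : Fin d) :
    ((maxEnt d).submatrix (Prod.mk i) (Prod.mk j)).trace = if i = j then (d : ℂ)⁻¹ else 0 := by
  simp [maxEnt, Matrix.trace, ite_and, eq_comm]

/-- Covariance moves the encoding unitary to the channel output. -/
theorem omegaG_eq_conj {G : Type} {d d' kN : ℕ} {U : G → Matrix (Fin d) (Fin d) ℂ}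
    {KN : Fin kN → Matrix (Fin d') (Fin d) ℂ} {V : G → Matrix (Fin d') (Fin d') ℂ}
    (hcov : ∀ (g : G) (X : Matrix (Fin d) (Fin d) ℂ),
      krausApply KN (U g * X * (U g)ᴴ) = V g * krausApply KN X * (V g)ᴴ) (g : G) :
    omegaG U KN g = ((1 : Matrix (Fin d) (Fin d) ℂ) ⊗ₖ V g) * idTensorApply KN (maxEnt d) *
      ((1 : Matrix (Fin d) (Fin d) ℂ) ⊗ₖ V g)ᴴ := by
  refine ext_submatrix_prodMk fun i j => ?_
  rw [omegaG, submatrix_idTensorApply, submatrix_one_kronecker_conj, hcov,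
    submatrix_one_kronecker_conj, submatrix_idTensorApply]

/-- Averaging over a one-design decouples the reference from the channel output. -/
theorem average_omegaG {G : Type} [Fintype G] {d d' kN : ℕ} {U : G → Matrix (Fin d) (Fin d) ℂ}
    (hUdesign : ∀ X : Matrix (Fin d) (Fin d) ℂ,
      (1 / (Fintype.card G : ℂ)) • ∑ g, U g * X * (U g)ᴴ = (X.trace / (d : ℂ)) • 1)
    (KN : Fin kN → Matrix (Fin d') (Fin d) ℂ) :
    (1 / (Fintype.card G : ℂ)) • ∑ g, omegaG U KN g =
      ((d : ℂ)⁻¹ • (1 : Matrix (Fin d) (Fin d) ℂ)) ⊗ₖ krausApply KN ((d : ℂ)⁻¹ • 1) := by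
  refine ext_submatrix_prodMk fun i j => ?_
  have hleft : ((1 / (Fintype.card G : ℂ)) • ∑ g, omegaG U KN g).submatrix
      (Prod.mk i) (Prod.mk j) =
      krausApply KN ((1 / (Fintype.card G : ℂ)) •
        ∑ g, U g * (maxEnt d).submatrix (Prod.mk i) (Prod.mk j) * (U g)ᴴ) := by
    rw [krausApply_smul, krausApply_sum]
    simp_rw [← submatrix_one_kronecker_conj, ← submatrix_idTensorApply]
    ext p q
    simp [omegaG, Matrix.sum_apply]
  rw [hleft, hUdesign, trace_submatrix_maxEnt, krausApply_smul, krausApply_smul]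
  ext p q
  by_cases h : i = j <;> simp [h, div_eq_mul_inv, mul_assoc]

/-- **Achievability/equality at the uniform distribution for covariant memory cells.**
For a covariant channel `N` (with respect to a one-design `U`), the Holevo-like quantity of the
uniform ensemble `{1/|G|, ω^g}` equals the entanglement-assisted mutual information
`log₂ d + H(N(I/d)) − H((id⊗N)(Φ_d))`. -/
theorem covariant_memory_cell_uniform_achievability
    {G : Type} [Fintype G] [Group G]
    {d d' : ℕ} (hd : 1 ≤ d)
    (U : G → Matrix (Fin d) (Fin d) ℂ)
    (hUunitary : ∀ g, U g * (U g)ᴴ = 1 ∧ (U g)ᴴ * U g = 1)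
    (hUmul : ∀ (g h : G) (X : Matrix (Fin d) (Fin d) ℂ),
      U g * (U h * X * (U h)ᴴ) * (U g)ᴴ = U (g * h) * X * (U (g * h))ᴴ)
    (hUdesign : ∀ X : Matrix (Fin d) (Fin d) ℂ,
      (1 / (Fintype.card G : ℂ)) • ∑ g, U g * X * (U g)ᴴ = (X.trace / (d : ℂ)) • 1)
    (kN : ℕ) (KN : Fin kN → Matrix (Fin d') (Fin d) ℂ)
    (hKN : ∑ j, (KN j)ᴴ * KN j = 1)
    (V : G → Matrix (Fin d') (Fin d') ℂ)
    (hVunitary : ∀ g, V g * (V g)ᴴ = 1 ∧ (V g)ᴴ * V g = 1)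
    (hcov : ∀ (g : G) (X : Matrix (Fin d) (Fin d) ℂ),
      krausApply KN (U g * X * (U g)ᴴ) = V g * krausApply KN X * (V g)ᴴ)
    :
    vnEntropy ((1 / (Fintype.card G : ℂ)) • ∑ g, omegaG U KN g) -
        (1 / (Fintype.card G : ℝ)) * ∑ g, vnEntropy (omegaG U KN g) =
      Real.logb 2 d + vnEntropy (krausApply KN ((d : ℂ)⁻¹ • 1)) -
        vnEntropy (idTensorApply KN (maxEnt d)) := by
  have : Nonempty G := ⟨1⟩
  have hdC : (d : ℂ) ≠ 0 := Nat.cast_ne_zero.mpr (by omega)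
  have hconst : ∀ g, vnEntropy (omegaG U KN g) = vnEntropy (idTensorApply KN (maxEnt d)) := by
    intro g
    rw [omegaG_eq_conj hcov]
    refine vnEntropy_unitary_conj ?_ (idTensorApply_isHermitian KN (maxEnt_isHermitian d))
    rw [conjTranspose_kronecker, ← mul_kronecker_mul, (hVunitary g).2]
    simp
  have hherm : ((d : ℂ)⁻¹ • (1 : Matrix (Fin d) (Fin d) ℂ)).IsHermitian := by
    simp [IsHermitian]
  have htr : (krausApply KN ((d : ℂ)⁻¹ • 1)).trace = 1 := by
    rw [trace_krausApply hKN]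
    simp [hdC]
  rw [average_omegaG hUdesign, vnEntropy_maximallyMixed_kronecker (by omega)
    (krausApply_isHermitian KN hherm) htr]
  simp [hconst]
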